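/- (Local a posteriori row-space error bound, conservative LSPG.) Under the stated hypotheses, with ζ_P := ‖Σ_P⁻¹ U_Pᵀ C̄‖ and E := Ψ (ΦᵀΨ)⁻¹ − Φ, the component of the state-space error in the row space of the constraints satisfies ‖V̄_Pᵀ e^n‖ ≤ Σ_{ℓ=0}^k ε_ℓ ( κ ‖Z̄_Pᵀ e^{n−ℓ}‖ + ζ_P ‖(I_N − Ψ(ΦᵀΨ)⁻¹Φᵀ) f(x_0 + Φ x̂^{n−ℓ}, t^{n−ℓ})‖ ) + Σ_{ℓ=1}^k γ_ℓ ‖V̄_Pᵀ e^{n−ℓ}‖ + (ζ_P / h) ‖E‖ Σ_{ℓ=0}^k |α_ℓ| ‖x̂^{n−ℓ}‖. -/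

import Mathlib

open Matrix Finset

noncomputable def euclNorm {n : ℕ} (v : Fin n → ℝ) : ℝ := Real.sqrt (∑ i, v i ^ 2)

noncomputable def matNorm {m n : ℕ} (M : Matrix (Fin m) (Fin n) ℝ) : ℝ :=
  ‖LinearMap.toContinuousLinearMap (Matrix.toEuclideanLin M)‖

theorem euclNorm_eq_norm {n : ℕ} (v : Fin n → ℝ) : euclNorm v = ‖WithLp.toLp 2 v‖ := by
  simp [euclNorm, EuclideanSpace.norm_eq]

theorem euclNorm_nonneg {n : ℕ} (v : Fin n → ℝ) : 0 ≤ euclNorm v :=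
  Real.sqrt_nonneg _

theorem euclNorm_add_le {n : ℕ} (v w : Fin n → ℝ) :
    euclNorm (v + w) ≤ euclNorm v + euclNorm w := by
  simpa only [euclNorm_eq_norm, WithLp.toLp_add] using
    norm_add_le (WithLp.toLp 2 v) (WithLp.toLp 2 w)

theorem euclNorm_sub_le {n : ℕ} (v w : Fin n → ℝ) :
    euclNorm (v - w) ≤ euclNorm v + euclNorm w := by
  simpa only [euclNorm_eq_norm, WithLp.toLp_sub] using
    norm_sub_le (WithLp.toLp 2 v) (WithLp.toLp 2 w)

theorem euclNorm_smul {n : ℕ} (c : ℝ) (v : Fin n → ℝ) :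
    euclNorm (c • v) = |c| * euclNorm v := by
  simp only [euclNorm_eq_norm, WithLp.toLp_smul, norm_smul, Real.norm_eq_abs]

theorem euclNorm_sum_le {n : ℕ} {ι : Type*} (S : Finset ι) (g : ι → Fin n → ℝ) :
    euclNorm (∑ i ∈ S, g i) ≤ ∑ i ∈ S, euclNorm (g i) := by
  simpa only [euclNorm_eq_norm, WithLp.toLp_sum] using
    norm_sum_le S (fun i => WithLp.toLp 2 (g i))

theorem euclNorm_sq {n : ℕ} (v : Fin n → ℝ) : euclNorm v ^ 2 = v ⬝ᵥ v := by
  rw [euclNorm, Real.sq_sqrt (Finset.sum_nonneg fun i _ => sq_nonneg _)]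
  simp [dotProduct, sq]

theorem matNorm_nonneg {m n : ℕ} (M : Matrix (Fin m) (Fin n) ℝ) : 0 ≤ matNorm M :=
  norm_nonneg _

theorem euclNorm_mulVec_le {m n : ℕ} (M : Matrix (Fin m) (Fin n) ℝ) (v : Fin n → ℝ) :
    euclNorm (M *ᵥ v) ≤ matNorm M * euclNorm v := by
  simpa only [euclNorm_eq_norm, matNorm, LinearMap.coe_toContinuousLinearMap',
    Matrix.toLpLin_toLp, Matrix.toLin'_apply] using
    (LinearMap.toContinuousLinearMap (Matrix.toEuclideanLin M)).le_opNorm (WithLp.toLp 2 v)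

/-- Pythagoras for a resolution of the identity `V Vᵀ + Z Zᵀ = 1`. -/
theorem euclNorm_sq_eq_of_resolution {n a b : ℕ} {V : Matrix (Fin n) (Fin a) ℝ}
    {Z : Matrix (Fin n) (Fin b) ℝ} (hVZ : V * Vᵀ + Z * Zᵀ = 1) (v : Fin n → ℝ) :
    euclNorm v ^ 2 = euclNorm (Vᵀ *ᵥ v) ^ 2 + euclNorm (Zᵀ *ᵥ v) ^ 2 := by
  have key : v ⬝ᵥ ((V * Vᵀ + Z * Zᵀ) *ᵥ v) = v ⬝ᵥ v := by rw [hVZ, one_mulVec]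
  rw [euclNorm_sq, euclNorm_sq, euclNorm_sq, ← key, add_mulVec, dotProduct_add,
    ← mulVec_mulVec, ← mulVec_mulVec, dotProduct_mulVec v V, dotProduct_mulVec v Z,
    ← mulVec_transpose, ← mulVec_transpose]

theorem euclNorm_transpose_mulVec_le_of_resolution {n a b : ℕ} {V : Matrix (Fin n) (Fin a) ℝ}
    {Z : Matrix (Fin n) (Fin b) ℝ} (hVZ : V * Vᵀ + Z * Zᵀ = 1) (v : Fin n → ℝ) :
    euclNorm (Vᵀ *ᵥ v) ≤ euclNorm v := by
  have := euclNorm_sq_eq_of_resolution hVZ v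
  exact le_of_sq_le_sq (by nlinarith [sq_nonneg (euclNorm (Zᵀ *ᵥ v))]) (euclNorm_nonneg v)

theorem euclNorm_le_add_of_resolution {n a b : ℕ} {V : Matrix (Fin n) (Fin a) ℝ}
    {Z : Matrix (Fin n) (Fin b) ℝ} (hVZ : V * Vᵀ + Z * Zᵀ = 1) (v : Fin n → ℝ) :
    euclNorm v ≤ euclNorm (Vᵀ *ᵥ v) + euclNorm (Zᵀ *ᵥ v) := by
  have := euclNorm_sq_eq_of_resolution hVZ v
  have h1 := euclNorm_nonneg (Vᵀ *ᵥ v)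
  have h2 := euclNorm_nonneg (Zᵀ *ᵥ v)
  exact le_of_sq_le_sq (by nlinarith [mul_nonneg h1 h2]) (add_nonneg h1 h2)

theorem sum_range_succ_eq_add_sum_Icc {M : Type*} [AddCommMonoid M] (g : ℕ → M) (k : ℕ) :
    ∑ i ∈ Finset.range (k + 1), g i = g 0 + ∑ i ∈ Finset.Icc 1 k, g i := by
  rw [Finset.range_eq_Ico, Finset.sum_eq_sum_Ico_succ_bot (Nat.succ_pos k)]
  rfl

/-- The scalar multistep step: solving a norm recursion for its leading term. -/
theorem le_of_multistep_bound (k : ℕ) (α β : ℕ → ℝ) (Δt κ h q : ℝ) (hh : 0 < h)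
    (hdef : h = |α 0| - |β 0| * κ * Δt) (a z r w : ℕ → ℝ)
    (hb : |α 0| * a 0 ≤ ∑ i ∈ Finset.range (k + 1),
        (|β i| * Δt * (κ * (a i + z i) + r i) + |α i| * (q * w i))
      + ∑ i ∈ Finset.Icc 1 k, |α i| * a i) :
    a 0 ≤ ∑ i ∈ Finset.range (k + 1), |β i| * Δt / h * (κ * z i + r i)
      + ∑ i ∈ Finset.Icc 1 k, (|α i| + |β i| * κ * Δt) / h * a i
      + q / h * ∑ i ∈ Finset.range (k + 1), |α i| * w i := by
  have hne := hh.ne'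
  have e1 : ∑ i ∈ Finset.range (k + 1),
        (|β i| * Δt * (κ * (a i + z i) + r i) + |α i| * (q * w i))
      = ∑ i ∈ Finset.range (k + 1), |β i| * Δt * (κ * z i + r i)
        + ∑ i ∈ Finset.range (k + 1), |β i| * κ * Δt * a i
        + q * ∑ i ∈ Finset.range (k + 1), |α i| * w i := by
    rw [Finset.mul_sum, ← Finset.sum_add_distrib, ← Finset.sum_add_distrib]
    exact Finset.sum_congr rfl fun i _ => by ring
  have e2 := sum_range_succ_eq_add_sum_Icc (fun i => |β i| * κ * Δt * a i) k
  have e3 : ∑ i ∈ Finset.Icc 1 k, (|α i| + |β i| * κ * Δt) * a i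
      = ∑ i ∈ Finset.Icc 1 k, |α i| * a i + ∑ i ∈ Finset.Icc 1 k, |β i| * κ * Δt * a i := by
    rw [← Finset.sum_add_distrib]
    exact Finset.sum_congr rfl fun i _ => by ring
  simp only [div_mul_eq_mul_div, ← Finset.sum_div, ← add_div]
  rw [le_div_iff₀ hh, e3, hdef]
  rw [e1] at hb
  linarith

/-- Local a posteriori error bound for the component of the conservative
LSPG state-space error in the row space of the constraints. -/
theorem conservative_lspg_rowspace_error_bound
    (N Nb p k : ℕ) (hN : 0 < N) (hNb : 0 < Nb) (hp : 0 < p) (hk : 1 ≤ k)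
    (Φ : Matrix (Fin N) (Fin p) ℝ) (hΦ : Φᵀ * Φ = 1)
    (C : Matrix (Fin Nb) (Fin N) ℝ)
    (Δt : ℝ) (hΔt : 0 < Δt)
    (α β : ℕ → ℝ) (hα0 : α 0 ≠ 0)
    (t : ℕ → ℝ) (x0 : Fin N → ℝ)
    (f : (Fin N → ℝ) → ℝ → (Fin N → ℝ))
    (κ : ℝ) (hκ : 0 < κ)
    (hLip : ∀ x y s, euclNorm (f x s - f y s) ≤ κ * euclNorm (x - y))
    (h : ℝ) (hdef : h = |α 0| - |β 0| * κ * Δt)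
    (hstab : |β 0| * κ * Δt < |α 0|)
    (ε γ : ℕ → ℝ)
    (hε : ∀ ℓ, ε ℓ = |β ℓ| * Δt / h)
    (hγ : ∀ ℓ, γ ℓ = (|α ℓ| + |β ℓ| * κ * Δt) / h)
    (rhat : (ℕ → Fin N → ℝ) → (Fin N → ℝ))
    (hrhat : ∀ y, rhat y = ∑ ℓ ∈ Finset.Icc 1 k,
      ((β ℓ * Δt) • f (x0 + y ℓ) (t ℓ) - α ℓ • y ℓ))
    (x : ℕ → Fin N → ℝ)
    (hFOM : α 0 • x 0 = (β 0 * Δt) • f (x0 + x 0) (t 0) + rhat x)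
    (Ψ : Matrix (Fin N) (Fin p) ℝ) (hinv : IsUnit (Ψᵀ * Φ).det)
    (xh : ℕ → Fin p → ℝ)
    (hcons : α 0 • (C * Φ).mulVec (xh 0)
      = (β 0 * Δt) • C.mulVec (f (x0 + Φ.mulVec (xh 0)) (t 0))
        + C.mulVec (rhat (fun ℓ => Φ.mulVec (xh ℓ))))
    (s : ℕ) (hs : s = (C * Ψ * (Φᵀ * Ψ)⁻¹).rank)
    (U : Matrix (Fin Nb) (Fin s) ℝ) (Sp : Matrix (Fin s) (Fin s) ℝ)
    (V : Matrix (Fin p) (Fin s) ℝ)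
    (hU : Uᵀ * U = 1) (hV : Vᵀ * V = 1)
    (hSdiag : ∀ i j : Fin s, i ≠ j → Sp i j = 0)
    (hSpos : ∀ i : Fin s, 0 < Sp i i)
    (hSVD : C * Ψ * (Φᵀ * Ψ)⁻¹ = U * Sp * Vᵀ)
    (Vb : Matrix (Fin N) (Fin s) ℝ) (hVb : Vb = Φ * V)
    (Z : Matrix (Fin N) (Fin (N - s)) ℝ)
    (hZ : Zᵀ * Z = 1) (hZV : Zᵀ * Vb = 0)
    (hdecomp : Vb * Vbᵀ + Z * Zᵀ = 1)
    (e : ℕ → Fin N → ℝ) (he : ∀ m, e m = x m - Φ.mulVec (xh m))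
    (ζ : ℝ) (hζ : ζ = matNorm (Sp⁻¹ * Uᵀ * C))
    (E : Matrix (Fin N) (Fin p) ℝ) (hE : E = Ψ * (Φᵀ * Ψ)⁻¹ - Φ) :
    euclNorm (Vbᵀ.mulVec (e 0)) ≤
      (∑ ℓ ∈ Finset.range (k + 1), ε ℓ * (κ * euclNorm (Zᵀ.mulVec (e ℓ))
        + ζ * euclNorm ((1 - Ψ * (Φᵀ * Ψ)⁻¹ * Φᵀ).mulVec
            (f (x0 + Φ.mulVec (xh ℓ)) (t ℓ)))))
      + (∑ ℓ ∈ Finset.Icc 1 k, γ ℓ * euclNorm (Vbᵀ.mulVec (e ℓ)))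
      + (ζ / h) * matNorm E *
          ∑ ℓ ∈ Finset.range (k + 1), |α ℓ| * euclNorm (xh ℓ) := by
  subst hζ hVb
  have hh : 0 < h := by linarith
  have hSp : IsUnit Sp.det := by
    have hd : Sp = Matrix.diagonal fun i => Sp i i := by
      ext i j
      by_cases hij : i = j
      · subst hij; simp
      · simp [hij, hSdiag i j hij]
    rw [hd, Matrix.det_diagonal]
    exact (Finset.prod_pos fun i _ => hSpos i).ne'.isUnit
  set P := Sp⁻¹ * Uᵀ * C with hP
  set W := Ψ * (Φᵀ * Ψ)⁻¹ with hW
  have hPW : P * W = Vᵀ := by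
    calc P * W = Sp⁻¹ * Uᵀ * (C * Ψ * (Φᵀ * Ψ)⁻¹) := by
          simp only [hP, hW, Matrix.mul_assoc]
      _ = Sp⁻¹ * (Uᵀ * U) * Sp * Vᵀ := by
          rw [hSVD]; simp only [Matrix.mul_assoc]
      _ = Vᵀ := by rw [hU, Matrix.mul_one, Matrix.nonsing_inv_mul _ hSp, Matrix.one_mul]
  have hPΦ : P * Φ = (Φ * V)ᵀ * Φ - P * E := by
    rw [hE, Matrix.mul_sub, hPW, Matrix.transpose_mul, Matrix.mul_assoc Vᵀ, hΦ, Matrix.mul_one,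
      sub_sub_cancel]
  have hPf : P = (Φ * V)ᵀ + P * (1 - W * Φᵀ) := by
    rw [Matrix.mul_sub, Matrix.mul_one, ← Matrix.mul_assoc, hPW, Matrix.transpose_mul,
      add_sub_cancel]
  set fx : ℕ → Fin N → ℝ := fun i => f (x0 + x i) (t i)
  set fr : ℕ → Fin N → ℝ := fun i => f (x0 + Φ *ᵥ xh i) (t i)
  have hFOM' : ∑ i ∈ Finset.range (k + 1), (α i • x i - (β i * Δt) • fx i) = 0 := by
    rw [sum_range_succ_eq_add_sum_Icc, hFOM, hrhat, add_sub_cancel_left,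
      ← Finset.sum_add_distrib]
    exact Finset.sum_eq_zero fun i _ => by simp only [fx]; abel
  have hROM : ∑ i ∈ Finset.range (k + 1),
      (α i • (P * Φ) *ᵥ xh i - (β i * Δt) • P *ᵥ fr i) = 0 := by
    have h1 := congrArg ((Sp⁻¹ * Uᵀ) *ᵥ ·) hcons
    simp only [mulVec_add, mulVec_smul, mulVec_mulVec, ← Matrix.mul_assoc] at h1
    rw [sum_range_succ_eq_add_sum_Icc, hP, h1, hrhat, add_sub_cancel_left, mulVec_sum,
      ← Finset.sum_add_distrib]
    refine Finset.sum_eq_zero fun i _ => ?_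
    simp only [fr, mulVec_sub, mulVec_smul, mulVec_mulVec]
    abel
  set g : ℕ → Fin s → ℝ := fun i =>
    (β i * Δt) • ((Φ * V)ᵀ *ᵥ (fx i - fr i) - P *ᵥ ((1 - W * Φᵀ) *ᵥ fr i))
      - α i • P *ᵥ (E *ᵥ xh i) with hg
  have hsum : ∑ i ∈ Finset.range (k + 1), (α i • (Φ * V)ᵀ *ᵥ e i - g i) = 0 := by
    have h1 := congrArg ((Φ * V)ᵀ *ᵥ ·) hFOM'
    simp only [mulVec_sum, mulVec_zero] at h1
    have h2 := congrArg₂ (· - ·) h1 hROM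
    simp only [← Finset.sum_sub_distrib, sub_zero] at h2
    rw [← h2]
    refine Finset.sum_congr rfl fun i _ => ?_
    have hPfr : P *ᵥ fr i = (Φ * V)ᵀ *ᵥ fr i + P *ᵥ ((1 - W * Φᵀ) *ᵥ fr i) := by
      conv_lhs => rw [hPf]
      rw [add_mulVec, mulVec_mulVec]
    rw [hPfr, hPΦ, he]
    simp only [hg, mulVec_sub, mulVec_smul, sub_mulVec, ← mulVec_mulVec, smul_sub, smul_add]
    abel
  have hlead : α 0 • (Φ * V)ᵀ *ᵥ e 0 = ∑ i ∈ Finset.range (k + 1), g i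
      - ∑ i ∈ Finset.Icc 1 k, α i • (Φ * V)ᵀ *ᵥ e i := by
    rw [Finset.sum_sub_distrib, sum_range_succ_eq_add_sum_Icc] at hsum
    rw [← sub_eq_zero.mp hsum, add_sub_cancel_right]
  have hgb : ∀ i, euclNorm (g i) ≤ |β i| * Δt *
      (κ * (euclNorm ((Φ * V)ᵀ *ᵥ e i) + euclNorm (Zᵀ *ᵥ e i))
        + matNorm P * euclNorm ((1 - W * Φᵀ) *ᵥ fr i))
      + |α i| * (matNorm P * matNorm E * euclNorm (xh i)) := by
    intro i
    refine (euclNorm_sub_le _ _).trans ?_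
    rw [euclNorm_smul, euclNorm_smul, abs_mul, abs_of_pos hΔt]
    have hf : euclNorm ((Φ * V)ᵀ *ᵥ (fx i - fr i))
        ≤ κ * (euclNorm ((Φ * V)ᵀ *ᵥ e i) + euclNorm (Zᵀ *ᵥ e i)) := by
      refine (euclNorm_transpose_mulVec_le_of_resolution hdecomp _).trans ((hLip _ _ _).trans ?_)
      rw [add_sub_add_left_eq_sub, ← he]
      exact mul_le_mul_of_nonneg_left (euclNorm_le_add_of_resolution hdecomp _) hκ.le
    have hPE : euclNorm (P *ᵥ (E *ᵥ xh i)) ≤ matNorm P * matNorm E * euclNorm (xh i) := by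
      rw [mul_assoc]
      exact (euclNorm_mulVec_le _ _).trans
        (mul_le_mul_of_nonneg_left (euclNorm_mulVec_le _ _) (matNorm_nonneg _))
    refine add_le_add (mul_le_mul_of_nonneg_left ?_ (by positivity))
      (mul_le_mul_of_nonneg_left hPE (abs_nonneg _))
    exact (euclNorm_sub_le _ _).trans (add_le_add hf (euclNorm_mulVec_le _ _))
  have hfinal := le_of_multistep_bound k α β Δt κ h (matNorm P * matNorm E) hh hdef
    (fun i => euclNorm ((Φ * V)ᵀ *ᵥ e i)) (fun i => euclNorm (Zᵀ *ᵥ e i))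
    (fun i => matNorm P * euclNorm ((1 - W * Φᵀ) *ᵥ fr i)) (fun i => euclNorm (xh i)) (by
      rw [← euclNorm_smul, hlead]
      refine (euclNorm_sub_le _ _).trans (add_le_add ?_ ?_)
      · exact (euclNorm_sum_le _ _).trans (Finset.sum_le_sum fun i _ => hgb i)
      · exact (euclNorm_sum_le _ _).trans (Finset.sum_le_sum fun i _ => (euclNorm_smul _ _).le))
  simp only [hε, hγ]
  rw [div_mul_eq_mul_div (matNorm P) h (matNorm E)]
  exact hfinal
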